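/- The function h is strictly positive on (0, ∞); equivalently, s/(1 − e^{−s}) > 1 + s/2 + s^2/12 − s^4/720 for every s > 0. -/

import Mathlib

open Real Set

/-- `h(s) = s/(1 − e^{−s}) − 1 − s/2 − s²/12 + s⁴/720`. -/
noncomputable def hfun (s : ℝ) : ℝ :=
  s / (1 - Real.exp (-s)) - 1 - s / 2 - s ^ 2 / 12 + s ^ 4 / 720

/-- A function vanishing at `0` with positive derivative on `(0, ∞)` is positive there. -/
theorem pos_of_hasDerivAt_pos {f f' : ℝ → ℝ} (hf : ∀ x, HasDerivAt f (f' x) x) (h0 : f 0 = 0)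
    (hf' : ∀ x, 0 < x → 0 < f' x) {x : ℝ} (hx : 0 < x) : 0 < f x := by
  have hmono : StrictMonoOn f (Ici 0) := by
    apply strictMonoOn_of_deriv_pos (convex_Ici 0)
    · exact fun y _ => (hf y).continuousAt.continuousWithinAt
    · intro y hy
      rw [interior_Ici] at hy
      rw [(hf y).deriv]
      exact hf' y hy
  simpa [h0] using hmono self_mem_Ici hx.le hx

theorem mul_cosh_add_mul_sinh_pos {t : ℝ} (ht : 0 < t) :
    0 < 7 * t * cosh t + (t ^ 2 - 7) * sinh t := by
  refine pos_of_hasDerivAt_pos (f := fun t => 7 * t * cosh t + (t ^ 2 - 7) * sinh t)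
    (f' := fun t => 9 * t * sinh t + t ^ 2 * cosh t) (fun x => ?_) (by simp) (fun x hx => ?_) ht
  · refine HasDerivAt.congr_deriv ((((hasDerivAt_id x).const_mul 7).mul (hasDerivAt_cosh x)).add
      ((((hasDerivAt_id x).pow 2).sub_const 7).mul (hasDerivAt_sinh x))) ?_
    simp
    ring
  · have := sinh_pos_iff.2 hx
    have := cosh_pos x
    positivity

theorem mul_sinh_sub_mul_cosh_pos {t : ℝ} (ht : 0 < t) :
    0 < (15 + 4 * t ^ 2) * sinh t - (15 * t - t ^ 3) * cosh t := by
  refine pos_of_hasDerivAt_pos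
    (f := fun t => (15 + 4 * t ^ 2) * sinh t - (15 * t - t ^ 3) * cosh t)
    (f' := fun t => t * (7 * t * cosh t + (t ^ 2 - 7) * sinh t)) (fun x => ?_) (by simp)
    (fun x hx => mul_pos hx (mul_cosh_add_mul_sinh_pos hx)) ht
  refine HasDerivAt.congr_deriv
    ((((((hasDerivAt_id x).pow 2).const_mul 4).const_add 15).mul (hasDerivAt_sinh x)).sub
    ((((hasDerivAt_id x).const_mul 15).sub ((hasDerivAt_id x).pow 3)).mul (hasDerivAt_cosh x))) ?_
  simp
  ring

/-- The lower Taylor bound `t coth t > 1 + t²/3 - t⁴/45`, with the denominator cleared. -/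
theorem taylor_mul_sinh_lt_mul_cosh {t : ℝ} (ht : 0 < t) :
    (1 + t ^ 2 / 3 - t ^ 4 / 45) * sinh t < t * cosh t := by
  rw [← sub_pos]
  refine pos_of_hasDerivAt_pos
    (f := fun t => t * cosh t - (1 + t ^ 2 / 3 - t ^ 4 / 45) * sinh t)
    (f' := fun t => t / 45 * ((15 + 4 * t ^ 2) * sinh t - (15 * t - t ^ 3) * cosh t))
    (fun x => ?_) (by simp)
    (fun x hx => mul_pos (by positivity) (mul_sinh_sub_mul_cosh_pos hx)) ht
  refine HasDerivAt.congr_deriv (((hasDerivAt_id x).mul (hasDerivAt_cosh x)).sub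
    ((((((hasDerivAt_id x).pow 2).div_const 3).const_add 1).sub
      (((hasDerivAt_id x).pow 4).div_const 45)).mul (hasDerivAt_sinh x))) ?_
  simp
  ring

/-- `h` is strictly positive on `(0, ∞)`; equivalently,
`s/(1 − e^{−s}) > 1 + s/2 + s²/12 − s⁴/720` for every `s > 0`. -/
theorem hfun_pos (s : ℝ) (hs : 0 < s) :
    0 < hfun s ∧ 1 + s / 2 + s ^ 2 / 12 - s ^ 4 / 720 < s / (1 - Real.exp (-s)) := by
  have key : 1 + s / 2 + s ^ 2 / 12 - s ^ 4 / 720 < s / (1 - Real.exp (-s)) := by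
    obtain ⟨t, rfl⟩ : ∃ t, s = 2 * t := ⟨s / 2, by ring⟩
    have ht : 0 < t := by linarith
    have hlt := taylor_mul_sinh_lt_mul_cosh ht
    have hexp : Real.exp (-(2 * t)) = Real.exp (-t) ^ 2 := by
      rw [← Real.exp_nat_mul]
      congr 1
      push_cast
      ring
    have hab : Real.exp (-t) * Real.exp t = 1 := by rw [← Real.exp_add]; simp
    have hden : 0 < 1 - Real.exp (-(2 * t)) := by
      rw [sub_pos, Real.exp_lt_one_iff]
      linarith
    rw [lt_div_iff₀ hden, hexp]
    rw [sinh_eq, cosh_eq] at hlt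
    have hmul := mul_lt_mul_of_pos_left hlt (Real.exp_pos (-t))
    linear_combination 2 * hmul + (t - (1 + t ^ 2 / 3 - t ^ 4 / 45)) * hab
  refine ⟨?_, key⟩
  unfold hfun
  linarith
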